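/- The seven seedings of Fin 8 given by the lists (0,1,4,5,2,3,6,7), (0,4,2,6,5,1,7,3), (0,5,6,3,7,2,1,4), (0,2,5,7,6,4,3,1), (0,3,1,2,4,7,5,6), (0,6,7,1,3,5,4,2), (0,7,3,4,1,6,2,5) — i.e., the seedings 0145-2367, 0426-5173, 0563-7214, 0257-6431, 0312-4756, 0671-3542, 0734-1625 obtained from the multiplication table of GF(2³) — form a stable Serial Knockout Competition on 8 players: for every i ∈ {1, 2, 3} and every pair of distinct players x, y ∈ Fin 8, exactly 2^{i−1} of these seven seedings s satisfy v_s(x, y) = i. -/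

import Mathlib

/-- Under seeding `s` (a bijection from players to leaf positions of a balanced
binary knockout tree with `k` rounds), two distinct players `x`, `y` can meet in round
`meetRound k s x y`, the least `i ≥ 1` with `⌊s x / 2^i⌋ = ⌊s y / 2^i⌋`. -/
noncomputable def meetRound {α : Type*} (k : ℕ) (s : α ≃ Fin (2 ^ k)) (x y : α) : ℕ :=
  sInf {i | 1 ≤ i ∧ (s x : ℕ) / 2 ^ i = (s y : ℕ) / 2 ^ i}

/-- The seeding determined by the list `l` of players assigned, in order, to the
8 leaves of the knockout tree: it sends each player to its position in the list. -/
noncomputable def seedingOfList (l : Fin 8 → Fin 8) (h : Function.Bijective l) :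
    Fin 8 ≃ Fin (2 ^ 3) :=
  (Equiv.ofBijective l h).symm

/-- The seven seedings 0145-2367, 0426-5173, 0563-7214, 0257-6431, 0312-4756,
0671-3542, 0734-1625 obtained from the multiplication table of GF(2³). -/
noncomputable def TGalois : Fin 7 → (Fin 8 ≃ Fin (2 ^ 3)) :=
  ![seedingOfList ![0, 1, 4, 5, 2, 3, 6, 7] (by decide),
    seedingOfList ![0, 4, 2, 6, 5, 1, 7, 3] (by decide),
    seedingOfList ![0, 5, 6, 3, 7, 2, 1, 4] (by decide),
    seedingOfList ![0, 2, 5, 7, 6, 4, 3, 1] (by decide),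
    seedingOfList ![0, 3, 1, 2, 4, 7, 5, 6] (by decide),
    seedingOfList ![0, 6, 7, 1, 3, 5, 4, 2] (by decide),
    seedingOfList ![0, 7, 3, 4, 1, 6, 2, 5] (by decide)]

theorem seedingOfList_eq_iff {l : Fin 8 → Fin 8} (h : Function.Bijective l)
    {x : Fin 8} {p : Fin (2 ^ 3)} : seedingOfList l h x = p ↔ x = l p :=
  Equiv.symm_apply_eq _

theorem meetRound_three {α : Type*} (s : α ≃ Fin (2 ^ 3)) (x y : α) :
    meetRound 3 s x y =
      if (s x : ℕ) / 2 = (s y : ℕ) / 2 then 1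
      else if (s x : ℕ) / 4 = (s y : ℕ) / 4 then 2 else 3 := by
  have hx := (s x).isLt
  have hy := (s y).isLt
  have hmem : (3 : ℕ) ∈ {i | 1 ≤ i ∧ (s x : ℕ) / 2 ^ i = (s y : ℕ) / 2 ^ i} :=
    ⟨by norm_num, by omega⟩
  have hle := Nat.sInf_le hmem
  obtain ⟨h1, h2⟩ := Nat.sInf_mem ⟨3, hmem⟩
  unfold meetRound
  split_ifs with hA hB
  · exact le_antisymm (Nat.sInf_le ⟨le_rfl, by simpa using hA⟩) h1
  all_goals
    generalize hm : sInf {i | 1 ≤ i ∧ (s x : ℕ) / 2 ^ i = (s y : ℕ) / 2 ^ i} = m at *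
  · have : m ≤ 2 := hm ▸ Nat.sInf_le ⟨by norm_num, by simpa using hB⟩
    interval_cases m <;> simp_all
  · interval_cases m <;> simp_all

/-- The position of each player in each of the seven lists defining `TGalois`. -/
def galoisPosition : Fin 7 → Fin 8 → Fin (2 ^ 3) :=
  ![![0, 1, 4, 5, 2, 3, 6, 7],
    ![0, 5, 2, 7, 1, 4, 3, 6],
    ![0, 6, 5, 3, 7, 1, 2, 4],
    ![0, 7, 1, 6, 5, 2, 4, 3],
    ![0, 2, 3, 1, 4, 6, 7, 5],
    ![0, 3, 7, 4, 6, 5, 1, 2],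
    ![0, 4, 6, 2, 3, 7, 5, 1]]

theorem TGalois_apply (j : Fin 7) (x : Fin 8) : TGalois j x = galoisPosition j x := by
  fin_cases j <;> refine (seedingOfList_eq_iff _).mpr ?_ <;> revert x <;> decide

/-- The seven seedings obtained from the multiplication table of GF(2³) form a stable
Serial Knockout Competition on 8 players: each pair of distinct players can meet in
round `i` in exactly `2^(i-1)` of the seven knockout tournaments, for `i = 1, 2, 3`. -/
theorem galois_table_stable :
    ∀ i : ℕ, 1 ≤ i → i ≤ 3 → ∀ x y : Fin 8, x ≠ y →
      (Finset.univ.filter fun j : Fin 7 =>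
        meetRound 3 (TGalois j) x y = i).card = 2 ^ (i - 1) := by
  intro i hi hi3
  simp only [meetRound_three, TGalois_apply]
  interval_cases i <;> decide +kernel
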